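/- arXiv:2305.01819 — 6 statements merged into one kernel-verified Lean document; each statement's English description precedes it below -/
import Mathlib

section
/- Let μ be a Borel probability measure on ℝ supported on [a,b] with 0 < a < b, and let m₁ := ∫ x dμ(x) > 0 be its mean. Then there exist r > 0 and an analytic function h on the open ball B(0,r) ⊆ ℂ such that for every z with 0 < |z| < r, the point m₁/z + h(z) lies outside [a,b] and T(m₁/z + h(z)) = z; that is, the local inverse of the T-transform near 0 has the form T⁻¹(z) = m₁/z + (analytic function of z). -/
open MeasureTheory

open Filter Topology in
lemma aux_dslope {f : ℂ → ℂ} (hf : AnalyticAt ℂ f 0) : AnalyticAt ℂ (dslope f 0) 0 := by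
  obtain ⟨p, hp⟩ := hf
  exact ⟨_, hp.has_fpower_series_dslope_fslope⟩

open Filter Topology in
lemma aux_inv {G : ℂ → ℂ} {m : ℂ} (hG : AnalyticAt ℂ G 0) (h0 : G 0 = 0) (hd : deriv G 0 = m)
    (hm : m ≠ 0) : ∃ g h : ℂ → ℂ, AnalyticAt ℂ g 0 ∧ g 0 = 0 ∧ AnalyticAt ℂ h 0 ∧
      ∀ᶠ z in 𝓝 (0:ℂ), G (g z) = z ∧ (z ≠ 0 → m / z + h z = (g z)⁻¹) := by
  have hd' : deriv G 0 ≠ 0 := hd ▸ hm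
  obtain ⟨g, hgdef⟩ : ∃ g, g = hG.hasStrictDerivAt.localInverse _ _ _ hd' := ⟨_, rfl⟩
  have hga : AnalyticAt ℂ g 0 := by
    have := hG.analyticAt_localInverse hd'
    rwa [h0, ← hgdef] at this
  have hg0 : g 0 = 0 := by
    have : g (G 0) = 0 := by
      rw [hgdef]; exact HasStrictFDerivAt.localInverse_apply_image ..
    rwa [h0] at this
  have hgd : deriv g 0 = m⁻¹ := by
    have := (hG.hasStrictDerivAt.to_localInverse hd').hasDerivAt.deriv
    rwa [h0, ← hgdef, hd] at this
  have hr : ∀ᶠ z in 𝓝 (0:ℂ), G (g z) = z := by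
    have := hG.hasStrictDerivAt.eventually_right_inverse hd'
    rwa [h0, ← hgdef] at this
  have hk := aux_dslope hga
  have hk0 : dslope g 0 0 = m⁻¹ := by rw [dslope_same, hgd]
  have hki := hk.inv (by rw [hk0]; exact inv_ne_zero hm)
  refine ⟨g, dslope (dslope g 0)⁻¹ 0, hga, hg0, aux_dslope hki, ?_⟩
  have hne : ∀ᶠ z in 𝓝 (0:ℂ), dslope g 0 z ≠ 0 :=
    hk.continuousAt.eventually_ne (by rw [hk0]; exact inv_ne_zero hm)
  filter_upwards [hr, hne] with z hz hz2
  refine ⟨hz, fun hz0 => ?_⟩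
  have e1 : g z = z * dslope g 0 z := by
    have := sub_smul_dslope g 0 z
    simp [hg0] at this
    exact this.symm
  have e2 := sub_smul_dslope (dslope g 0)⁻¹ 0 z
  simp only [Pi.inv_apply, hk0, inv_inv, sub_zero, smul_eq_mul] at e2
  have e3 : dslope (dslope g 0)⁻¹ 0 z = ((dslope g 0 z)⁻¹ - m) / z := by
    rw [← e2]; field_simp
  rw [e3, e1]
  field_simp
  ring

/-- `∫ x w / (1 - w x) dμ`, i.e. `T(1/w)`. -/
noncomputable def auxG (μ : Measure ℝ) (w : ℂ) : ℂ := ∫ x : ℝ, (x : ℂ) * w / (1 - w * x) ∂μ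

lemma aux_bound {b x : ℝ} (hb : 0 < b) (hx0 : 0 ≤ x) (hxb : x ≤ b) {w : ℂ}
    (hw : ‖w‖ < 1 / (2 * b)) : 1 / 2 ≤ ‖1 - w * (x : ℂ)‖ := by
  have h1 : ‖w * (x : ℂ)‖ ≤ 1 / 2 := by
    rw [norm_mul, Complex.norm_real, Real.norm_of_nonneg hx0]
    calc ‖w‖ * x ≤ 1 / (2 * b) * b := by gcongr
      _ = 1 / 2 := by field_simp
  have := norm_sub_norm_le (1 : ℂ) (w * x)
  rw [norm_one] at this
  linarith

lemma aux_deriv (a b : ℝ) (ha : 0 < a) (hab : a < b) (μ : Measure ℝ) [IsProbabilityMeasure μ]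
    (hsupp : ∀ᵐ x ∂μ, x ∈ Set.Icc a b) {w : ℂ} (hw : w ∈ Metric.ball (0 : ℂ) (1 / (2 * b))) :
    HasDerivAt (auxG μ) (∫ x : ℝ, (x : ℂ) / (1 - w * x) ^ 2 ∂μ) w := by
  have hb : 0 < b := ha.trans hab
  have hmeas : ∀ w : ℂ, AEStronglyMeasurable (fun x : ℝ => (x : ℂ) * w / (1 - w * x)) μ := by
    intro w
    apply Measurable.aestronglyMeasurable
    fun_prop
  refine (hasDerivAt_integral_of_dominated_loc_of_deriv_le (μ := μ)
    (F := fun w (x : ℝ) => (x : ℂ) * w / (1 - w * x))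
    (F' := fun w (x : ℝ) => (x : ℂ) / (1 - w * x) ^ 2)
    (bound := fun _ => b / (1 / 2) ^ 2) (Metric.isOpen_ball.mem_nhds hw)
    (Filter.Eventually.of_forall hmeas) ?_ ?_ ?_ (integrable_const _) ?_).2
  · refine Integrable.of_bound (hmeas w) (b * (1 / (2 * b)) / (1 / 2)) ?_
    filter_upwards [hsupp] with x hx
    have hx0 : 0 ≤ x := ha.le.trans hx.1
    rw [mem_ball_zero_iff] at hw
    rw [norm_div, norm_mul, Complex.norm_real, Real.norm_of_nonneg hx0]
    have := aux_bound hb hx0 hx.2 hw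
    have := hx.2
    gcongr
  · apply Measurable.aestronglyMeasurable
    fun_prop
  · filter_upwards [hsupp] with x hx w hw
    have hx0 : 0 ≤ x := ha.le.trans hx.1
    rw [mem_ball_zero_iff] at hw
    rw [norm_div, norm_pow, Complex.norm_real, Real.norm_of_nonneg hx0]
    have := aux_bound hb hx0 hx.2 hw
    have := hx.2
    gcongr
  · filter_upwards [hsupp] with x hx w hw
    have hx0 : 0 ≤ x := ha.le.trans hx.1
    rw [mem_ball_zero_iff] at hw
    have h := aux_bound hb hx0 hx.2 hw
    have hne : 1 - w * (x : ℂ) ≠ 0 := by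
      intro h'
      rw [h', norm_zero] at h
      linarith
    have h1 : HasDerivAt (fun w : ℂ => (x : ℂ) * w) (x : ℂ) w := by
      simpa using (hasDerivAt_id w).const_mul (x : ℂ)
    have h2 : HasDerivAt (fun w : ℂ => 1 - w * (x : ℂ)) (-(x : ℂ)) w := by
      simpa using ((hasDerivAt_id w).mul_const (x : ℂ)).const_sub 1
    convert! h1.div h2 hne using 1
    congr 1
    ring

/-- The local inverse of the T-transform near `0` has the form `m₁/z + (analytic)`,
where `m₁ > 0` is the mean of the measure. -/
theorem t_transform_inverse_expansion
    (a b : ℝ) (ha : 0 < a) (hab : a < b) (μ : Measure ℝ) [IsProbabilityMeasure μ]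
    (hsupp : μ (Set.Icc a b)ᶜ = 0) :
    0 < (∫ x : ℝ, x ∂μ) ∧
    ∃ r > (0 : ℝ), ∃ h : ℂ → ℂ,
      (∀ z ∈ Metric.ball (0 : ℂ) r, AnalyticAt ℂ h z) ∧
      ∀ z : ℂ, 0 < ‖z‖ → ‖z‖ < r →
        (((∫ x : ℝ, x ∂μ : ℝ) : ℂ) / z + h z ∉ Complex.ofReal '' Set.Icc a b) ∧
        (∫ x : ℝ, (x : ℂ) / ((((∫ x : ℝ, x ∂μ : ℝ) : ℂ) / z + h z) - (x : ℂ)) ∂μ) = z := by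
  have hb : 0 < b := ha.trans hab
  have hae : ∀ᵐ x ∂μ, x ∈ Set.Icc a b := hsupp
  have hint : Integrable (fun x : ℝ => x) μ := by
    refine Integrable.of_bound (by fun_prop) b ?_
    filter_upwards [hae] with x hx
    rw [Real.norm_of_nonneg (ha.le.trans hx.1)]
    exact hx.2
  have hpos : 0 < ∫ x : ℝ, x ∂μ := by
    have : ∫ _ : ℝ, a ∂μ ≤ ∫ x : ℝ, x ∂μ := by
      refine integral_mono_ae (integrable_const _) hint ?_
      filter_upwards [hae] with x hx using hx.1
    simp at this
    linarith
  refine ⟨hpos, ?_⟩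
  have hb2 : 0 < 1 / (2 * b) := by positivity
  have hG : AnalyticAt ℂ (auxG μ) 0 := by
    have : DifferentiableOn ℂ (auxG μ) (Metric.ball 0 (1 / (2 * b))) := fun w hw =>
      (aux_deriv a b ha hab μ hae hw).differentiableAt.differentiableWithinAt
    exact this.analyticAt (Metric.ball_mem_nhds _ hb2)
  have hG0 : auxG μ 0 = 0 := by simp [auxG]
  have hd : deriv (auxG μ) 0 = ((∫ x : ℝ, x ∂μ : ℝ) : ℂ) := by
    rw [(aux_deriv a b ha hab μ hae (Metric.mem_ball_self hb2)).deriv]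
    simp only [zero_mul, sub_zero, one_pow, div_one]
    exact integral_ofReal
  obtain ⟨g, h, hg, hg0, hh, hev⟩ := aux_inv hG hG0 hd (by exact_mod_cast hpos.ne')
  have hsmall : ∀ᶠ z in nhds (0 : ℂ), ‖g z‖ < 1 / (2 * b) := by
    have : Filter.Tendsto (fun z => ‖g z‖) (nhds 0) (nhds ‖g 0‖) := hg.continuousAt.norm
    rw [hg0, norm_zero] at this
    exact this.eventually_lt_const hb2
  obtain ⟨r, hr, hball⟩ := Metric.eventually_nhds_iff_ball.1
    ((hh.eventually_analyticAt).and (hev.and hsmall))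
  refine ⟨r, hr, h, fun z hz => (hball z hz).1, fun z hz hzr => ?_⟩
  obtain ⟨-, ⟨hGz, hinv⟩, hgz⟩ := hball z (mem_ball_zero_iff.2 hzr)
  have hz0 : z ≠ 0 := norm_pos_iff.1 hz
  have hgne : g z ≠ 0 := by
    intro h'
    rw [h', hG0] at hGz
    exact hz0 hGz.symm
  rw [hinv hz0]
  constructor
  · rintro ⟨x, hx, hxe⟩
    have hx0 : 0 ≤ x := ha.le.trans hx.1
    have h1 := aux_bound hb hx0 hx.2 hgz
    rw [hxe, mul_inv_cancel₀ hgne, sub_self, norm_zero] at h1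
    linarith
  · conv_rhs => rw [← hGz]
    unfold auxG
    congr 1
    ext x
    have : (g z)⁻¹ - (x : ℂ) = (1 - g z * x) / g z := by field_simp
    rw [this, div_div_eq_mul_div]
end

section
/- Let μ be a Borel probability measure on ℝ with density ψ(x)·√(x−a)·√(b−x) on [a,b], where ψ : [a,b] → ℝ is continuous and 0 < a < b. Then for every y ∈ ℂ with Im y < 0 one has T(y) ≠ 0 and Im( 1/y + 1/(y·T(y)) ) < 0. -/
open MeasureTheory

/-- For a measure with square-root behavior at the boundary on `[a,b]` with `0 < a < b`,
and any `y` in the open lower half-plane, `T(y) ≠ 0` and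
`Im(1/y + 1/(y T(y))) < 0`. -/
theorem t_transform_lower_half_plane
    (a b : ℝ) (ha : 0 < a) (hab : a < b) (ψ : ℝ → ℝ)
    (hψ : ContinuousOn ψ (Set.Icc a b)) (μ : Measure ℝ) [IsProbabilityMeasure μ]
    (hdens : μ = volume.withDensity (fun x => ENNReal.ofReal
      (Set.indicator (Set.Icc a b)
        (fun x => ψ x * Real.sqrt (x - a) * Real.sqrt (b - x)) x)))
    (y : ℂ) (hy : y.im < 0) :
    (∫ x : ℝ, (x : ℂ) / (y - (x : ℂ)) ∂μ) ≠ 0 ∧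
    (1 / y + 1 / (y * ∫ x : ℝ, (x : ℂ) / (y - (x : ℂ)) ∂μ)).im < 0 := by
  set s : ℝ := y.re with hs
  obtain ⟨t, ht⟩ : ∃ t : ℝ, t = -y.im := ⟨_, rfl⟩
  have ht0 : 0 < t := by linarith
  have hyim : y.im = -t := by linarith
  have hac : μ ≪ volume := by rw [hdens]; exact withDensity_absolutelyContinuous _ _
  have hcompl : μ (Set.Icc a b)ᶜ = 0 := by
    rw [hdens, withDensity_apply _ measurableSet_Icc.compl]
    rw [setLIntegral_congr_fun (g := fun _ => 0) measurableSet_Icc.compl]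
    · simp
    · intro x hx
      simp only [Set.indicator_of_notMem hx, ENNReal.ofReal_zero]
  have hres : μ.restrict (Set.Icc a b) = μ := by
    apply Measure.restrict_eq_self_of_ae_mem
    exact hcompl
  have hint : ∀ f : ℝ → ℝ, Continuous f → Integrable f μ := by
    intro f hf
    rw [← hres]
    exact hf.continuousOn.integrableOn_compact isCompact_Icc
  have hD : ∀ x : ℝ, 0 < (s - x) ^ 2 + t ^ 2 := fun x => by positivity
  set p : ℝ → ℝ := fun x => ((s - x) ^ 2 + t ^ 2)⁻¹ with hp
  have hp0 : ∀ x, 0 < p x := fun x => inv_pos.mpr (hD x)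
  have hpc : Continuous p := Continuous.inv₀ (by fun_prop) (fun x => (hD x).ne')
  have hpos : ∀ f : ℝ → ℝ, Continuous f → ∀ c : ℝ, (∀ x ∈ Set.Icc a b, x ≠ c → 0 < f x) →
      0 < ∫ x, f x ∂μ := by
    intro f hf c h
    have hae : ∀ᵐ x ∂μ, 0 < f x := by
      have h1 : ∀ᵐ x ∂μ, x ∈ Set.Icc a b := hcompl
      have h2 : ∀ᵐ x ∂μ, x ≠ c := hac.ae_le (Measure.ae_ne volume c)
      filter_upwards [h1, h2] with x hx1 hx2 using h x hx1 hx2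
    rw [integral_pos_iff_support_of_nonneg_ae (hae.mono fun x hx => hx.le) (hint f hf)]
    have : μ (Function.support f) = 1 := by
      rw [← prob_compl_eq_zero_iff]
      · exact hae.mono fun x hx => hx.ne'
      · exact (hf.measurable (measurableSet_singleton 0).compl)
    rw [this]; exact one_pos
  have iA := hint p hpc
  have iB := hint (fun x => x * p x) (by fun_prop)
  have iC := hint (fun x => x ^ 2 * p x) (by fun_prop)
  obtain ⟨A, hA⟩ : ∃ A, A = ∫ x, p x ∂μ := ⟨_, rfl⟩
  obtain ⟨B, hB⟩ : ∃ A, A = ∫ x, x * p x ∂μ := ⟨_, rfl⟩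
  obtain ⟨C, hC⟩ : ∃ A, A = ∫ x, x ^ 2 * p x ∂μ := ⟨_, rfl⟩
  have hA0 : 0 < A := hA ▸ hpos p hpc 0 (fun x _ _ => hp0 x)
  have hB0 : 0 < B := hB ▸ hpos _ (by fun_prop) 0
    (fun x hx _ => mul_pos (ha.trans_le hx.1) (hp0 x))
  have hlin : ∀ u v w : ℝ, ∫ x, (u * p x + v * (x * p x) + w * (x ^ 2 * p x)) ∂μ
      = u * A + v * B + w * C := by
    intro u v w
    rw [integral_add (hint _ (by fun_prop)) (iC.const_mul w),
      integral_add (iA.const_mul u) (iB.const_mul v), integral_const_mul, integral_const_mul,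
      integral_const_mul, hA, hB, hC]
  have hCS : 0 < A * C - B ^ 2 := by
    have h1 := hpos (fun x => (B / A) ^ 2 * p x + (-2 * (B / A)) * (x * p x) + 1 * (x ^ 2 * p x))
      (by fun_prop) (B / A) (fun x _ hx => by
        have : 0 < (x - B / A) ^ 2 * p x := mul_pos (pow_two_pos_of_ne_zero (sub_ne_zero.mpr hx)) (hp0 x)
        nlinarith)
    rw [hlin] at h1
    have h2 : A * ((B / A) ^ 2 * A + (-2 * (B / A)) * B + 1 * C) = A * C - B ^ 2 := by
      field_simp
      ring
    rw [← h2]; positivity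
  have h1 : (s ^ 2 + t ^ 2) * A + (-2 * s) * B + 1 * C = 1 := by
    rw [← hlin]
    have : ∀ x, (s ^ 2 + t ^ 2) * p x + (-2 * s) * (x * p x) + 1 * (x ^ 2 * p x) = 1 := by
      intro x
      have : ((s - x) ^ 2 + t ^ 2) * p x = 1 := mul_inv_cancel₀ (hD x).ne'
      linear_combination this
    simp_rw [this]
    simp
  have hye : y = (s : ℂ) - t * Complex.I := by
    apply Complex.ext <;> simp [hs, hyim]
  have hT : (∫ x : ℝ, (x : ℂ) / (y - (x : ℂ)) ∂μ) = ((s * B - C : ℝ) : ℂ) + ((t * B : ℝ) : ℂ) * Complex.I := by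
    have e : ∀ x : ℝ, (x : ℂ) / (y - (x : ℂ)) =
        ((0 * p x + s * (x * p x) + (-1) * (x ^ 2 * p x) : ℝ) : ℂ)
          + ((0 * p x + t * (x * p x) + 0 * (x ^ 2 * p x) : ℝ) : ℂ) * Complex.I := by
      intro x
      have hne : y - (x : ℂ) ≠ 0 := by
        intro h
        have := congrArg Complex.im h
        simp at this
        linarith
      have hq : (((s - x) ^ 2 + t ^ 2 : ℝ) : ℂ) * (p x : ℂ) = 1 := by
        rw [← Complex.ofReal_mul, mul_inv_cancel₀ (hD x).ne', Complex.ofReal_one]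
      rw [div_eq_iff hne, hye]
      push_cast at hq ⊢
      linear_combination (-(x : ℂ)) * hq + (x : ℂ) * (p x) * t ^ 2 * Complex.I_sq
    simp_rw [e]
    rw [integral_add, integral_mul_const, integral_complex_ofReal, integral_complex_ofReal, hlin, hlin]
    · push_cast
      ring
    · exact (hint (fun x => 0 * p x + s * (x * p x) + (-1) * (x ^ 2 * p x)) (by fun_prop)).ofReal (𝕜 := ℂ)
    · exact (hint (fun x => 0 * p x + t * (x * p x) + 0 * (x ^ 2 * p x))
        (by fun_prop)).ofReal (𝕜 := ℂ) |>.mul_const _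
  rw [hT]
  set T : ℂ := ((s * B - C : ℝ) : ℂ) + ((t * B : ℝ) : ℂ) * Complex.I with hTd
  have hTre : T.re = s * B - C := by simp [hTd]
  have hTim : T.im = t * B := by simp [hTd]
  have hT0 : T ≠ 0 := by
    intro h
    rw [h] at hTim
    have := mul_pos ht0 hB0
    simp at hTim
    rcases hTim with h | h <;> linarith
  refine ⟨hT0, ?_⟩
  have hy0 : y ≠ 0 := by
    intro h
    rw [h] at hy; simp at hy
  set G : ℂ := ((s * A - B : ℝ) : ℂ) + ((t * A : ℝ) : ℂ) * Complex.I with hG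
  have hGre : G.re = s * A - B := by simp [hG]
  have hGim : G.im = t * A := by simp [hG]
  have hyG : y * G = 1 + T := by
    apply Complex.ext
    · rw [Complex.mul_re, hGre, hGim, Complex.add_re 1 T, hTre, hyim, ← hs, Complex.one_re]
      linear_combination h1
    · rw [Complex.mul_im, hGre, hGim, Complex.add_im 1 T, hTim, hyim, ← hs, Complex.one_im]
      ring
  have hE : 1 / y + 1 / (y * T) = G / T := by
    field_simp
    rw [hyG]; ring
  rw [hE, Complex.div_im, hGre, hGim, hTre, hTim, ← sub_div]
  apply div_neg_of_neg_of_pos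
  · have := mul_pos ht0 hCS
    nlinarith
  · exact Complex.normSq_pos.mpr hT0
end

section
/- Let μ be a Borel probability measure on ℝ supported on [a,b] with 0 < a < b, absolutely continuous with a continuous density. Then for every real w > b: T(w) + T(w)² + w·T'(w) < 0, where T(w) = ∫ x/(w − x) dμ(x) and T'(w) = −∫ x/(w − x)² dμ(x). -/
open MeasureTheory

/-- For a probability measure with continuous density supported in `[a,b]`, `0 < a < b`,
and real `w > b`, one has `T(w) + T(w)² + w T'(w) < 0`. -/
theorem t_transform_inequality
    (a b : ℝ) (ha : 0 < a) (hab : a < b) (f : ℝ → ℝ) (hf : Continuous f)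
    (μ : Measure ℝ) [IsProbabilityMeasure μ] (hsupp : μ (Set.Icc a b)ᶜ = 0)
    (hdens : μ = volume.withDensity (fun x => ENNReal.ofReal (f x)))
    (w : ℝ) (hw : b < w) :
    (∫ x : ℝ, x / (w - x) ∂μ) + (∫ x : ℝ, x / (w - x) ∂μ) ^ 2 +
        w * (-∫ x : ℝ, x / (w - x) ^ 2 ∂μ) < 0 := by
  have hae : ∀ᵐ x ∂μ, x ∈ Set.Icc a b := by
    rw [ae_iff]; exact hsupp
  have hac : μ ≪ volume := by
    rw [hdens]; exact withDensity_absolutelyContinuous _ _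
  have hne : ∀ c : ℝ, ∀ᵐ x ∂μ, x ≠ c := by
    intro c
    rw [ae_iff]
    apply hac
    simp
  have hbd : ∀ᵐ x ∂μ, ‖x / (w - x)‖ ≤ b / (w - b) := by
    filter_upwards [hae] with x hx
    have h1 : 0 < w - x := by linarith [hx.2]
    have h0 : 0 < x := by linarith [hx.1]
    rw [Real.norm_of_nonneg (by positivity)]
    exact div_le_div₀ (by linarith) hx.2 (by linarith) (by linarith [hx.2])
  have hm : Measurable (fun x : ℝ => x / (w - x)) := by fun_prop
  have hg : Integrable (fun x : ℝ => x / (w - x)) μ :=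
    Integrable.of_bound hm.aestronglyMeasurable _ hbd
  have hg2 : Integrable (fun x : ℝ => (x / (w - x)) ^ 2) μ := by
    refine Integrable.of_bound (hm.pow_const 2).aestronglyMeasurable ((b / (w - b)) ^ 2) ?_
    filter_upwards [hbd] with x hx
    rw [norm_pow]
    gcongr
  have hT' : w * (∫ x : ℝ, x / (w - x) ^ 2 ∂μ)
      = (∫ x : ℝ, x / (w - x) ∂μ) + ∫ x : ℝ, (x / (w - x)) ^ 2 ∂μ := by
    rw [← integral_add hg hg2, ← integral_const_mul]
    apply integral_congr_ae
    filter_upwards [hae] with x hx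
    have h1 : w - x ≠ 0 := by linarith [hx.2]
    field_simp
    ring
  set m := ∫ x : ℝ, x / (w - x) ∂μ with hmdef
  have hvar : ∫ x : ℝ, (x / (w - x) - m) ^ 2 ∂μ
      = (∫ x : ℝ, (x / (w - x)) ^ 2 ∂μ) - m ^ 2 := by
    have e : ∀ x : ℝ, (x / (w - x) - m) ^ 2
        = (x / (w - x)) ^ 2 - 2 * m * (x / (w - x)) + m ^ 2 := fun x => by ring
    simp_rw [e]
    have hs : Integrable (fun x : ℝ => (x / (w - x)) ^ 2 - 2 * m * (x / (w - x))) μ :=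
      hg2.sub (hg.const_mul _)
    rw [integral_add hs (integrable_const _),
      integral_sub hg2 (hg.const_mul _), integral_const_mul, ← hmdef]
    simp
    ring
  have hint : Integrable (fun x : ℝ => (x / (w - x) - m) ^ 2) μ := by
    have e : (fun x : ℝ => (x / (w - x) - m) ^ 2)
        = fun x => (x / (w - x)) ^ 2 - 2 * m * (x / (w - x)) + m ^ 2 := by
      funext x; ring
    rw [e]
    exact (hg2.sub (hg.const_mul _)).add (integrable_const _)
  have hnn : 0 ≤ ∫ x : ℝ, (x / (w - x) - m) ^ 2 ∂μ :=
    integral_nonneg fun x => sq_nonneg _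
  have hpos : 0 < ∫ x : ℝ, (x / (w - x) - m) ^ 2 ∂μ := by
    refine lt_of_le_of_ne hnn fun h => ?_
    have h0 := (integral_eq_zero_iff_of_nonneg (fun x => sq_nonneg _) hint).1 h.symm
    have hF : ∀ᵐ x ∂μ, False := by
      filter_upwards [h0, hae, hne (m * w / (1 + m))] with x hx hx2 hx3
      have h1 : 0 < w - x := by linarith [hx2.2]
      have hx0 : 0 < x := by linarith [hx2.1]
      have hxm : x / (w - x) = m := by
        have := pow_eq_zero_iff (two_ne_zero) |>.1 hx
        linarith
      have hmp : 0 < m := hxm ▸ div_pos hx0 h1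
      rw [div_eq_iff h1.ne'] at hxm
      apply hx3
      rw [eq_div_iff (by positivity)]
      linarith
    exact hF.exists.elim fun _ h => h
  linarith
end

section
/- Let μ be a Borel probability measure on ℝ with support contained in [−r, r] for some r > 0, and let G be its Cauchy transform. Then there exists a function R, analytic on the open ball of radius 1/(6r) centered at 0 in ℂ, such that for every w with 0 < |w| < 1/(6r), the point R(w) + 1/w lies in ℂ \ [−r, r] and G(R(w) + 1/w) = w. -/
open MeasureTheory

/-- The fixed point map `T w R = ∫ x / (1 + w R - w x) dμ`. -/
noncomputable def rtT (μ : Measure ℝ) (w R : ℂ) : ℂ :=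
  ∫ x : ℝ, (x : ℂ) * (1 + w * R - w * x)⁻¹ ∂μ

/-- The auxiliary function `H z = ∫ x / (1 - z x) dμ`. -/
noncomputable def rtH (μ : Measure ℝ) (z : ℂ) : ℂ :=
  ∫ x : ℝ, (x : ℂ) * (1 - z * x)⁻¹ ∂μ

/-- Iterates of the fixed point map. -/
noncomputable def rtIter (μ : Measure ℝ) : ℕ → ℂ → ℂ
  | 0 => fun _ => 0
  | n + 1 => fun w => rtT μ w (rtIter μ n w)

theorem rt_ae {r : ℝ} {μ : Measure ℝ} (hsupp : μ (Set.Icc (-r) r)ᶜ = 0) :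
    ∀ᵐ x ∂μ, |x| ≤ r := by
  rw [ae_iff]
  convert hsupp using 2
  ext x
  simp only [Set.mem_ofPred_eq, Set.mem_compl_iff, Set.mem_Icc, abs_le]

theorem rt_small {r : ℝ} (hr : 0 < r) {w : ℂ} (hw : ‖w‖ < 1 / (6 * r)) : ‖w‖ * r < 1 / 6 := by
  rw [lt_div_iff₀ (by positivity)] at hw
  linarith

theorem rt_lower {r : ℝ} {w R : ℂ} {x : ℝ} (hw : ‖w‖ * r < 1 / 6)
    (hR : ‖R‖ ≤ 2 * r) (hx : |x| ≤ r) : 1 / 2 ≤ ‖1 + w * R - w * x‖ := by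
  have h1 : ‖w * R‖ ≤ 1 / 3 := by
    rw [norm_mul]
    nlinarith [mul_le_mul_of_nonneg_left hR (norm_nonneg w)]
  have h2 : ‖w * x‖ ≤ 1 / 6 := by
    rw [norm_mul, Complex.norm_real, Real.norm_eq_abs]
    nlinarith [mul_le_mul_of_nonneg_left hx (norm_nonneg w)]
  have h3 : ‖(1 : ℂ)‖ ≤ ‖1 + w * R - w * x‖ + ‖w * R‖ + ‖w * x‖ := by
    calc ‖(1 : ℂ)‖ = ‖(1 + w * R - w * x) - w * R + w * x‖ := by congr 1; ring
      _ ≤ ‖(1 + w * R - w * x) - w * R‖ + ‖w * x‖ := norm_add_le _ _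
      _ ≤ _ := by gcongr; exact norm_sub_le _ _
  rw [norm_one] at h3
  linarith

theorem rt_inv {r : ℝ} {w R : ℂ} {x : ℝ} (hw : ‖w‖ * r < 1 / 6)
    (hR : ‖R‖ ≤ 2 * r) (hx : |x| ≤ r) : ‖(1 + w * R - w * x)⁻¹‖ ≤ 2 := by
  have := rt_lower hw hR hx
  rw [norm_inv]
  calc _ ≤ (1 / 2 : ℝ)⁻¹ := by gcongr
    _ = 2 := by norm_num

theorem rt_term {r : ℝ} {w R : ℂ} {x : ℝ} (hw : ‖w‖ * r < 1 / 6)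
    (hR : ‖R‖ ≤ 2 * r) (hx : |x| ≤ r) : ‖(x : ℂ) * (1 + w * R - w * x)⁻¹‖ ≤ 2 * r := by
  rw [norm_mul, Complex.norm_real, Real.norm_eq_abs]
  have := rt_inv hw hR hx
  have h0 : 0 ≤ r := (abs_nonneg x).trans hx
  calc _ ≤ r * 2 := by gcongr
    _ = 2 * r := by ring

theorem rt_integrable {r : ℝ} {μ : Measure ℝ} [IsProbabilityMeasure μ]
    (hae : ∀ᵐ x ∂μ, |x| ≤ r) {w R : ℂ} (hw : ‖w‖ * r < 1 / 6) (hR : ‖R‖ ≤ 2 * r) :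
    Integrable (fun x : ℝ => (x : ℂ) * (1 + w * R - w * x)⁻¹) μ := by
  refine Integrable.of_bound (C := 2 * r) ?_ ?_
  · exact Measurable.aestronglyMeasurable (by fun_prop)
  · filter_upwards [hae] with x hx using rt_term hw hR hx

theorem rt_integrable_inv {r : ℝ} {μ : Measure ℝ} [IsProbabilityMeasure μ]
    (hae : ∀ᵐ x ∂μ, |x| ≤ r) {w R : ℂ} (hw : ‖w‖ * r < 1 / 6) (hR : ‖R‖ ≤ 2 * r) :
    Integrable (fun x : ℝ => (1 + w * R - w * x)⁻¹) μ := by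
  refine Integrable.of_bound (C := 2) ?_ ?_
  · exact Measurable.aestronglyMeasurable (by fun_prop)
  · filter_upwards [hae] with x hx using rt_inv hw hR hx

theorem rtT_norm {r : ℝ} {μ : Measure ℝ} [IsProbabilityMeasure μ]
    (hae : ∀ᵐ x ∂μ, |x| ≤ r) {w R : ℂ} (hw : ‖w‖ * r < 1 / 6) (hR : ‖R‖ ≤ 2 * r) :
    ‖rtT μ w R‖ ≤ 2 * r := by
  have h := norm_integral_le_of_norm_le_const (μ := μ)
    (f := fun x : ℝ => (x : ℂ) * (1 + w * R - w * x)⁻¹) (C := 2 * r)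
    (by filter_upwards [hae] with x hx using rt_term hw hR hx)
  simpa [rtT] using h

theorem rtT_lip {r : ℝ} {μ : Measure ℝ} [IsProbabilityMeasure μ]
    (hae : ∀ᵐ x ∂μ, |x| ≤ r) {w R S : ℂ} (hw : ‖w‖ * r < 1 / 6) (hR : ‖R‖ ≤ 2 * r)
    (hS : ‖S‖ ≤ 2 * r) :
    dist (rtT μ w R) (rtT μ w S) ≤ 2 / 3 * dist R S := by
  rw [dist_eq_norm, dist_eq_norm, rtT, rtT,
    ← integral_sub (rt_integrable hae hw hR) (rt_integrable hae hw hS)]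
  have h := norm_integral_le_of_norm_le_const (μ := μ)
    (f := fun x : ℝ => (x : ℂ) * (1 + w * R - w * x)⁻¹ - (x : ℂ) * (1 + w * S - w * x)⁻¹)
    (C := 2 / 3 * ‖R - S‖) (by
      filter_upwards [hae] with x hx
      have a0 : 1 + w * R - w * x ≠ 0 := by
        rw [← norm_pos_iff]; linarith [rt_lower hw hR hx]
      have b0 : 1 + w * S - w * x ≠ 0 := by
        rw [← norm_pos_iff]; linarith [rt_lower hw hS hx]
      have e : (x : ℂ) * (1 + w * R - w * x)⁻¹ - (x : ℂ) * (1 + w * S - w * x)⁻¹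
          = (w * x) * ((1 + w * R - w * x)⁻¹ * (1 + w * S - w * x)⁻¹) * (S - R) := by
        have hA := mul_inv_cancel₀ a0
        have hB := mul_inv_cancel₀ b0
        linear_combination (x : ℂ) * (1 + w * S - w * x)⁻¹ * hA
          - (x : ℂ) * (1 + w * R - w * x)⁻¹ * hB
      have h2 : ‖w * x‖ ≤ 1 / 6 := by
        rw [norm_mul, Complex.norm_real, Real.norm_eq_abs]
        nlinarith [mul_le_mul_of_nonneg_left hx (norm_nonneg w)]
      have i1 := rt_inv hw hR hx
      have i2 := rt_inv hw hS hx
      rw [e, norm_mul, norm_mul, norm_mul (_⁻¹), norm_sub_rev S R]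
      calc _ ≤ 1 / 6 * (2 * 2) * ‖R - S‖ := by gcongr
        _ = _ := by ring)
  simpa using h

theorem rtH_diff {r : ℝ} (hr : 0 < r) {μ : Measure ℝ} [IsProbabilityMeasure μ]
    (hae : ∀ᵐ x ∂μ, |x| ≤ r) {z : ℂ} (hz : ‖z‖ < 1 / (2 * r)) :
    DifferentiableAt ℂ (rtH μ) z := by
  have key : ∀ y ∈ Metric.ball (0 : ℂ) (1 / (2 * r)), ∀ x : ℝ, |x| ≤ r →
      1 / 2 ≤ ‖1 - y * x‖ := by
    intro y hy x hx
    rw [mem_ball_zero_iff, lt_div_iff₀ (by positivity)] at hy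
    have h2 : ‖y * x‖ ≤ 1 / 2 := by
      rw [norm_mul, Complex.norm_real, Real.norm_eq_abs]
      nlinarith [mul_le_mul_of_nonneg_left hx (norm_nonneg y)]
    have := norm_sub_norm_le (1 : ℂ) (y * x)
    rw [norm_one] at this
    linarith
  have keyinv : ∀ y ∈ Metric.ball (0 : ℂ) (1 / (2 * r)), ∀ x : ℝ, |x| ≤ r →
      ‖(1 - y * x)⁻¹‖ ≤ 2 := by
    intro y hy x hx
    have := key y hy x hx
    rw [norm_inv]
    calc _ ≤ (1 / 2 : ℝ)⁻¹ := by gcongr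
      _ = 2 := by norm_num
  have hzb : z ∈ Metric.ball (0 : ℂ) (1 / (2 * r)) := by simpa using hz
  have := hasDerivAt_integral_of_dominated_loc_of_deriv_le (μ := μ) (𝕜 := ℂ)
    (F := fun (y : ℂ) (x : ℝ) => (x : ℂ) * (1 - y * x)⁻¹)
    (F' := fun (y : ℂ) (x : ℝ) => (x : ℂ) ^ 2 * ((1 - y * x)⁻¹) ^ 2)
    (x₀ := z) (s := Metric.ball (0 : ℂ) (1 / (2 * r))) (bound := fun _ => r ^ 2 * 2 ^ 2)
    (Metric.isOpen_ball.mem_nhds hzb)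
    (Filter.Eventually.of_forall fun y => Measurable.aestronglyMeasurable (by fun_prop))
    (Integrable.of_bound (C := r * 2) (Measurable.aestronglyMeasurable (by fun_prop)) (by
      filter_upwards [hae] with x hx
      have := keyinv z hzb x hx
      rw [norm_mul, Complex.norm_real, Real.norm_eq_abs]
      gcongr))
    (Measurable.aestronglyMeasurable (by fun_prop))
    (by
      filter_upwards [hae] with x hx y hy
      have := keyinv y hy x hx
      rw [norm_mul, norm_pow, norm_pow, Complex.norm_real, Real.norm_eq_abs]
      gcongr)
    (integrable_const _)
    (by
      filter_upwards [hae] with x hx y hy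
      have h0 : 1 - y * (x : ℂ) ≠ 0 := by
        rw [← norm_pos_iff]; linarith [key y hy x hx]
      have h1 : HasDerivAt (fun y : ℂ => 1 - y * (x : ℂ)) (-(x : ℂ)) y := by
        simpa using ((hasDerivAt_id y).mul_const (x : ℂ)).const_sub 1
      refine ((h1.inv h0).const_mul (x : ℂ)).congr_deriv ?_
      field_simp)
  exact this.2.differentiableAt

theorem rt_one_add {r : ℝ} (hr : 0 < r) {w R : ℂ} (hw : ‖w‖ * r < 1 / 6)
    (hR : ‖R‖ ≤ 2 * r) : 2 / 3 ≤ ‖1 + w * R‖ := by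
  have h1 : ‖w * R‖ ≤ 1 / 3 := by
    rw [norm_mul]
    nlinarith [mul_le_mul_of_nonneg_left hR (norm_nonneg w)]
  have := norm_sub_le_norm_add (1 : ℂ) (w * R)
  rw [norm_one] at this
  linarith

theorem rtT_eq (μ : Measure ℝ) {w R : ℂ} (h : 1 + w * R ≠ 0) :
    rtT μ w R = rtH μ (w / (1 + w * R)) * (1 + w * R)⁻¹ := by
  rw [rtT, rtH, ← integral_mul_const]
  congr 1
  ext x
  rw [mul_assoc, ← mul_inv]
  congr 2
  field_simp

theorem rtIter_norm {r : ℝ} (hr : 0 < r) {μ : Measure ℝ} [IsProbabilityMeasure μ]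
    (hae : ∀ᵐ x ∂μ, |x| ≤ r) {w : ℂ} (hw : ‖w‖ * r < 1 / 6) (n : ℕ) :
    ‖rtIter μ n w‖ ≤ 2 * r := by
  induction n with
  | zero => simp [rtIter, hr.le]
  | succ n ih => exact rtT_norm hae hw ih

theorem rtIter_diff {r : ℝ} (hr : 0 < r) {μ : Measure ℝ} [IsProbabilityMeasure μ]
    (hae : ∀ᵐ x ∂μ, |x| ≤ r) (n : ℕ) :
    DifferentiableOn ℂ (rtIter μ n) (Metric.ball 0 (1 / (6 * r))) := by
  induction n with
  | zero => exact differentiableOn_const _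
  | succ n ih =>
    have hs : ∀ w ∈ Metric.ball (0 : ℂ) (1 / (6 * r)), 2 / 3 ≤ ‖1 + w * rtIter μ n w‖ := by
      intro w hw
      have hw' := rt_small hr (mem_ball_zero_iff.1 hw)
      exact rt_one_add hr hw' (rtIter_norm hr hae hw' n)
    have hs0 : ∀ w ∈ Metric.ball (0 : ℂ) (1 / (6 * r)), 1 + w * rtIter μ n w ≠ 0 := by
      intro w hw
      rw [← norm_pos_iff]; linarith [hs w hw]
    have hd : DifferentiableOn ℂ (fun w => 1 + w * rtIter μ n w)
        (Metric.ball 0 (1 / (6 * r))) := (differentiableOn_id.mul ih).const_add 1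
    have h2 : DifferentiableOn ℂ (fun w => rtH μ (w / (1 + w * rtIter μ n w)) *
        (1 + w * rtIter μ n w)⁻¹) (Metric.ball 0 (1 / (6 * r))) := by
      refine DifferentiableOn.mul ?_ (hd.inv hs0)
      intro w hw
      have hq : DifferentiableWithinAt ℂ (fun w => w / (1 + w * rtIter μ n w))
        (Metric.ball 0 (1 / (6 * r))) w := (differentiableOn_id.div hd hs0) w hw
      refine DifferentiableAt.comp_differentiableWithinAt w (g := rtH μ) (rtH_diff hr hae ?_) hq
      have hw' := rt_small hr (mem_ball_zero_iff.1 hw)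
      have := hs w hw
      rw [norm_div, div_lt_div_iff₀ (by linarith) (by positivity)]
      nlinarith
    exact h2.congr fun w hw => rtT_eq μ (hs0 w hw)

theorem rt_fixed {r : ℝ} (hr : 0 < r) {μ : Measure ℝ} [IsProbabilityMeasure μ]
    (hae : ∀ᵐ x ∂μ, |x| ≤ r) {w R : ℂ} (hw : ‖w‖ * r < 1 / 6) (hR : ‖R‖ ≤ 2 * r)
    (hfix : R = rtT μ w R) : ∫ x : ℝ, (1 + w * R - w * x)⁻¹ ∂μ = 1 := by
  have h0 : 1 + w * R ≠ 0 := by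
    rw [← norm_pos_iff]; linarith [rt_one_add hr hw hR]
  have h1 : ∫ x : ℝ, ((1 + w * R) * (1 + w * R - w * x)⁻¹ -
      w * ((x : ℂ) * (1 + w * R - w * x)⁻¹)) ∂μ = 1 := by
    have : ∫ x : ℝ, ((1 + w * R) * (1 + w * R - w * x)⁻¹ -
      w * ((x : ℂ) * (1 + w * R - w * x)⁻¹)) ∂μ = ∫ x : ℝ, (1 : ℂ) ∂μ := by
      refine integral_congr_ae ?_
      filter_upwards [hae] with x hx
      have a0 : 1 + w * R - w * x ≠ 0 := by
        rw [← norm_pos_iff]; linarith [rt_lower hw hR hx]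
      rw [← mul_assoc, ← sub_mul, mul_inv_cancel₀ a0]
    rw [this]; simp
  rw [integral_sub ((rt_integrable_inv hae hw hR).const_mul _)
    ((rt_integrable hae hw hR).const_mul _), integral_const_mul, integral_const_mul] at h1
  change _ - w * rtT μ w R = 1 at h1
  rw [← hfix] at h1
  apply mul_left_cancel₀ h0
  linear_combination h1

/-- The R-transform of a measure supported in `[-r, r]` exists and is analytic on the
ball of radius `1/(6r)` around `0`: there it satisfies `G(R(w) + 1/w) = w`. -/
theorem r_transform_analytic
    (r : ℝ) (hr : 0 < r) (μ : Measure ℝ) [IsProbabilityMeasure μ]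
    (hsupp : μ (Set.Icc (-r) r)ᶜ = 0) :
    ∃ R : ℂ → ℂ,
      (∀ w ∈ Metric.ball (0 : ℂ) (1 / (6 * r)), AnalyticAt ℂ R w) ∧
      ∀ w : ℂ, 0 < ‖w‖ → ‖w‖ < 1 / (6 * r) →
        (R w + 1 / w ∉ Complex.ofReal '' Set.Icc (-r) r) ∧
        (∫ x : ℝ, ((R w + 1 / w) - (x : ℂ))⁻¹ ∂μ) = w := by
  have hae := rt_ae hsupp
  have hgeo : ∀ w : ℂ, ‖w‖ < 1 / (6 * r) → ∀ n,
      dist (rtIter μ n w) (rtIter μ (n + 1) w) ≤ 2 * r * (2 / 3) ^ n := by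
    intro w hw n
    have hw' := rt_small hr hw
    induction n with
    | zero =>
      have := rtIter_norm hr hae hw' 1
      simpa [rtIter] using this
    | succ n ih =>
      refine (rtT_lip hae hw' (rtIter_norm hr hae hw' n)
        (rtIter_norm hr hae hw' (n + 1))).trans ?_
      rw [pow_succ]
      linarith
  have hlim : ∀ w : ℂ, ∃ R : ℂ, ‖w‖ < 1 / (6 * r) →
      Filter.Tendsto (fun n => rtIter μ n w) Filter.atTop (nhds R) := by
    intro w
    by_cases hw : ‖w‖ < 1 / (6 * r)
    · obtain ⟨R, hR⟩ := cauchySeq_tendsto_of_complete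
        (cauchySeq_of_le_geometric (2 / 3) (2 * r) (by norm_num) (hgeo w hw))
      exact ⟨R, fun _ => hR⟩
    · exact ⟨0, fun h => absurd h hw⟩
  choose R hR using hlim
  have hunif : TendstoUniformlyOn (rtIter μ) R Filter.atTop (Metric.ball 0 (1 / (6 * r))) := by
    rw [Metric.tendstoUniformlyOn_iff]
    intro ε hε
    have ht : Filter.Tendsto (fun n : ℕ => 2 * r * (2 / 3 : ℝ) ^ n / (1 - 2 / 3))
        Filter.atTop (nhds 0) := by
      have := ((tendsto_pow_atTop_nhds_zero_of_lt_one (r := (2 / 3 : ℝ)) (by norm_num)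
        (by norm_num)).const_mul (2 * r)).div_const (1 - 2 / 3)
      simpa using this
    filter_upwards [ht.eventually (gt_mem_nhds hε)] with n hn w hw
    have hw' := mem_ball_zero_iff.1 hw
    rw [dist_comm]
    exact (dist_le_of_le_geometric_of_tendsto (2 / 3) (2 * r) (by norm_num) (hgeo w hw')
      (hR w hw') n).trans_lt hn
  have hdiff : DifferentiableOn ℂ R (Metric.ball 0 (1 / (6 * r))) :=
    hunif.tendstoLocallyUniformlyOn.differentiableOn
      (Filter.Eventually.of_forall fun n => rtIter_diff hr hae n) Metric.isOpen_ball
  refine ⟨R, fun w hw => hdiff.analyticAt (Metric.isOpen_ball.mem_nhds hw), ?_⟩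
  intro w hw0 hw
  have hw' := rt_small hr hw
  have hne : w ≠ 0 := norm_pos_iff.1 hw0
  have hRn : ‖R w‖ ≤ 2 * r :=
    le_of_tendsto (hR w hw).norm (Filter.Eventually.of_forall fun n => rtIter_norm hr hae hw' n)
  have hfix : R w = rtT μ w (R w) := by
    refine tendsto_nhds_unique ((Filter.tendsto_add_atTop_iff_nat 1).2 (hR w hw)) ?_
    rw [tendsto_iff_dist_tendsto_zero]
    have h0 := (tendsto_iff_dist_tendsto_zero.1 (hR w hw)).const_mul (2 / 3)
    rw [mul_zero] at h0
    exact squeeze_zero (fun _ => dist_nonneg)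
      (fun n => rtT_lip hae hw' (rtIter_norm hr hae hw' n) hRn) h0
  have halg : ∀ x : ℝ, R w + 1 / w - x = (1 + w * R w - w * x) * w⁻¹ := by
    intro x
    field_simp
    ring
  constructor
  · rintro ⟨x, hx, hxe⟩
    have h1 := rt_lower hw' hRn (abs_le.2 hx)
    have h2 := halg x
    rw [← hxe, sub_self] at h2
    have h3 : 1 + w * R w - w * x = 0 := by
      rcases mul_eq_zero.1 h2.symm with h | h
      · exact h
      · exact absurd h (inv_ne_zero hne)
    rw [h3, norm_zero] at h1
    linarith
  · simp_rw [halg, mul_inv, inv_inv]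
    rw [integral_mul_const, rt_fixed hr hae hw' hRn hfix, one_mul]
end

section
/- Complex Morse lemma: let U ⊆ ℂ be open, let f : U → ℂ be analytic on U, and let p ∈ U be a nondegenerate critical point of f, i.e. f'(p) = 0 and f''(p) ≠ 0. Then there exist an open neighborhood V of 0 in ℂ, an open neighborhood Ũ ⊆ U of p, and an analytic function φ : V → ℂ that is a bijection from V onto Ũ, with φ(0) = p and f(φ(w)) = f(p) + w² for all w ∈ V. -/
open Filter Topology in
/-- A local analytic square root of `f - f p`. -/
theorem exists_local_sqrt (f : ℂ → ℂ) (p : ℂ) (hf : AnalyticAt ℂ f p)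
    (h1 : deriv f p = 0) (h2 : deriv (deriv f) p ≠ 0) :
    ∃ ψ : ℂ → ℂ, AnalyticAt ℂ ψ p ∧ ψ p = 0 ∧ deriv ψ p ≠ 0 ∧
      ∀ᶠ z in 𝓝 p, f z = f p + ψ z ^ 2 := by
  have ho : analyticOrderAt (fun z => f z - f p) p = (2 : ℕ) := by
    have ha := hf.analyticOrderAt_deriv_add_one
    have hb := hf.deriv.analyticOrderAt_sub_eq_one_of_deriv_ne_zero h2
    simp only [h1, sub_zero] at hb
    rw [← ha, hb]
    norm_num
  obtain ⟨g, hg, hg0, hfg⟩ :=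
    (AnalyticAt.analyticOrderAt_eq_natCast (hf.fun_sub analyticAt_const)).1 ho
  obtain ⟨c, hc⟩ := IsAlgClosed.exists_pow_nat_eq (g p) (n := 2) (by norm_num)
  have hc0 : c ≠ 0 := by
    rintro rfl
    exact hg0 (by rw [← hc]; norm_num)
  have hh : AnalyticAt ℂ (fun z => c * Complex.exp (Complex.log (g z / g p) / 2)) p := by
    refine analyticAt_const.mul (AnalyticAt.cexp ((AnalyticAt.clog (hg.div_const) ?_).div_const))
    simp [hg0]
  set h : ℂ → ℂ := fun z => c * Complex.exp (Complex.log (g z / g p) / 2) with hhdef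
  have hhp : h p = c := by simp [hhdef, hg0]
  have hsub : HasDerivAt (fun z : ℂ => z - p) 1 p := (hasDerivAt_id p).sub_const p
  refine ⟨fun z => (z - p) * h z, (analyticAt_id.fun_sub analyticAt_const).fun_mul hh, by simp,
    ?_, ?_⟩
  · have := (hsub.fun_mul hh.differentiableAt.hasDerivAt).deriv
    rw [this]
    simpa [hhp] using hc0
  · filter_upwards [hfg, hg.continuousAt.eventually_ne hg0] with z hz hgz
    have hsq : h z ^ 2 = g z := by
      simp only [hhdef]
      rw [mul_pow, hc, ← Complex.exp_nat_mul]
      have : ((2 : ℕ) : ℂ) * (Complex.log (g z / g p) / 2) = Complex.log (g z / g p) := by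
        push_cast; ring
      rw [this, Complex.exp_log (div_ne_zero hgz hg0)]
      field_simp
    rw [mul_pow, hsq]
    rw [smul_eq_mul] at hz
    linear_combination hz

open Filter Topology in
/-- Complex Morse lemma: near a nondegenerate critical point `p` of an analytic function
`f`, there is an analytic change of variables `φ` with `φ(0) = p` and
`f(φ(w)) = f(p) + w²`. -/
theorem complex_morse_lemma
    (U : Set ℂ) (hU : IsOpen U) (f : ℂ → ℂ)
    (hf : ∀ z ∈ U, AnalyticAt ℂ f z) (p : ℂ) (hp : p ∈ U)
    (h1 : deriv f p = 0) (h2 : deriv (deriv f) p ≠ 0) :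
    ∃ (V Ut : Set ℂ) (φ : ℂ → ℂ),
      IsOpen V ∧ (0 : ℂ) ∈ V ∧ IsOpen Ut ∧ Ut ⊆ U ∧ p ∈ Ut ∧
      (∀ z ∈ V, AnalyticAt ℂ φ z) ∧ Set.BijOn φ V Ut ∧ φ 0 = p ∧
      ∀ w ∈ V, f (φ w) = f p + w ^ 2 := by
  obtain ⟨ψ, hψ, hψp, hψ', hsq⟩ := exists_local_sqrt f p (hf p hp) h1 h2
  have hd := hψ.hasStrictDerivAt.hasStrictFDerivAt_equiv hψ'
  let R : OpenPartialHomeomorph ℂ ℂ := hd.toOpenPartialHomeomorph _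
  have hRc : ∀ z, R z = ψ z := fun z => rfl
  have hpR : p ∈ R.source := hd.mem_toOpenPartialHomeomorph_source
  have hR0 : R.symm 0 = p := by
    rw [← hψp, ← hRc]; exact R.left_inv hpR
  have h0R : (0 : ℂ) ∈ R.target := by
    rw [← hψp, ← hRc]; exact R.map_source hpR
  have hsymm : AnalyticAt ℂ R.symm 0 := by
    have := hψ.analyticAt_localInverse hψ'
    rw [hψp] at this
    exact this
  have hA := hsymm.eventually_analyticAt
  have hW : ∀ᶠ z in 𝓝 p, z ∈ U ∧ f z = f p + ψ z ^ 2 := (hU.eventually_mem hp).and hsq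
  obtain ⟨W, hWs, hWo, hpW⟩ := eventually_nhds_iff.1 hW
  obtain ⟨A, hAs, hAo, h0A⟩ := eventually_nhds_iff.1 hA
  let e := ((R.restrOpen W hWo).symm).restrOpen A hAo
  have hes : ∀ w ∈ e.source, w ∈ R.target ∧ R.symm w ∈ W ∧ w ∈ A := by
    intro w hw
    simp [e] at hw
    tauto
  have h0 : (0 : ℂ) ∈ e.source := by
    simp [e, h0R, hR0, hpW, h0A]
  have hec : ∀ w, e w = R.symm w := fun w => rfl
  refine ⟨e.source, e.target, R.symm, e.open_source, h0, e.open_target, ?_, ?_, ?_, e.bijOn, hR0, ?_⟩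
  · intro z hz
    have h := hes _ (e.map_target hz)
    rw [← hec, e.right_inv hz] at h
    exact (hWs z h.2.1).1
  · rw [← hR0]; exact e.map_source h0
  · intro w hw
    exact hAs w (hes w hw).2.2
  · intro w hw
    obtain ⟨ht, hw', -⟩ := hes w hw
    rw [(hWs _ hw').2, ← hRc, R.right_inv ht]
end

section
/- Let μ be a Borel probability measure on ℝ with support contained in [a,b], a < b, with Cauchy transform G and Joukowski map J. Then the function 𝒢 : 𝔻 → ℂ defined on the open unit disk by 𝒢(0) = 0 and 𝒢(v) = G(J(v)) for 0 < |v| < 1 is analytic on the whole open unit disk. -/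
open MeasureTheory

/-- Lower bound for the quadratic `v² - 2tv + 1` with `t ∈ [-1,1]`. -/
lemma joukowski_quad_lower (t : ℝ) (h1 : -1 ≤ t) (h2 : t ≤ 1) (v : ℂ) (r : ℝ)
    (hv : ‖v‖ ≤ r) (hr : r < 1) :
    (1 - r) ^ 2 ≤ ‖v ^ 2 - 2 * (t : ℂ) * v + 1‖ := by
  set s : ℝ := Real.sqrt (1 - t ^ 2) with hs
  have hs2 : s ^ 2 = 1 - t ^ 2 := Real.sq_sqrt (by nlinarith)
  have hs2' : (s : ℂ) ^ 2 = 1 - (t : ℂ) ^ 2 := by exact_mod_cast hs2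
  have hn : ∀ u : ℝ, u ^ 2 = 1 - t ^ 2 → ‖(t : ℂ) + u * Complex.I‖ = 1 := by
    intro u hu
    rw [Complex.norm_add_mul_I]
    rw [hu]; simp
  have hfac : v ^ 2 - 2 * (t : ℂ) * v + 1
      = (((t : ℂ) + s * Complex.I) - v) * (((t : ℂ) + (-s : ℝ) * Complex.I) - v) := by
    push_cast
    linear_combination (-(s : ℂ) ^ 2) * Complex.I_sq * (-1) - hs2'
  have hb : ∀ u : ℝ, u ^ 2 = 1 - t ^ 2 → 1 - r ≤ ‖(t : ℂ) + u * Complex.I - v‖ := by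
    intro u hu
    have := norm_sub_norm_le ((t : ℂ) + u * Complex.I) v
    rw [hn u hu] at this
    linarith
  rw [hfac, norm_mul, sq]
  exact mul_le_mul (hb s hs2) (hb (-s) (by simpa using hs2)) (by linarith) (norm_nonneg _)

/-- The composition `𝒢 = G ∘ J` of the Cauchy transform with the Joukowski map,
extended by `𝒢(0) = 0`, is analytic on the whole open unit disk. -/
theorem cauchy_joukowski_analytic_on_disk
    (a b : ℝ) (hab : a < b) (μ : Measure ℝ) [IsProbabilityMeasure μ]
    (hsupp : μ (Set.Icc a b)ᶜ = 0)
    (J : ℂ → ℂ)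
    (hJ : ∀ v : ℂ, J v = (v + v⁻¹) / 2 * (((b : ℂ) - (a : ℂ)) / 2) + ((b : ℂ) + (a : ℂ)) / 2)
    (𝒢 : ℂ → ℂ) (h0 : 𝒢 0 = 0)
    (h𝒢 : ∀ v : ℂ, v ≠ 0 → 𝒢 v = ∫ x : ℝ, (J v - (x : ℂ))⁻¹ ∂μ) :
    ∀ v ∈ Metric.ball (0 : ℂ) 1, AnalyticAt ℂ 𝒢 v := by
  have hae : ∀ᵐ x ∂μ, x ∈ Set.Icc a b := by
    rw [ae_iff]; exact hsupp
  have hba : 0 < b - a := sub_pos.2 hab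
  have hbaC : (b : ℂ) - a ≠ 0 := by exact_mod_cast hba.ne'
  let t : ℝ → ℝ := fun x => (2 * x - (b + a)) / (b - a)
  have htm : Measurable t := by fun_prop
  have ht1 : ∀ x ∈ Set.Icc a b, -1 ≤ t x := by
    intro x hx
    simp only [t]
    rw [le_div_iff₀ hba]; linarith [hx.1]
  have ht2 : ∀ x ∈ Set.Icc a b, t x ≤ 1 := by
    intro x hx
    simp only [t]
    rw [div_le_iff₀ hba]; linarith [hx.2]
  let P : ℂ → ℝ → ℂ := fun v x => v ^ 2 - 2 * (t x : ℂ) * v + 1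
  let k : ℂ := 4 / ((b : ℂ) - a)
  let F : ℂ → ℝ → ℂ := fun v x => k * (v / P v x)
  let F' : ℂ → ℝ → ℂ := fun v x => k * ((1 - v ^ 2) / P v x ^ 2)
  have hPm : ∀ v, Measurable (P v) := by
    intro v
    have : Measurable (fun x => (t x : ℂ)) := Complex.measurable_ofReal.comp htm
    simp only [P]
    fun_prop
  have hG : 𝒢 = fun v => ∫ x, F v x ∂μ := by
    funext v
    by_cases hv : v = 0
    · subst hv; simp [F, h0]
    · rw [h𝒢 v hv]
      congr 1
      funext x
      have : J v - x = ((b : ℂ) - a) / 4 * (P v x / v) := by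
        rw [hJ]
        simp only [P, t]
        push_cast
        field_simp
        ring
      rw [this]
      simp only [F, k]
      rw [mul_inv, inv_div, inv_div]
  have hlow : ∀ r : ℝ, r < 1 → ∀ x ∈ Set.Icc a b, ∀ v : ℂ, ‖v‖ ≤ r → (1 - r) ^ 2 ≤ ‖P v x‖ :=
    fun r hr x hx v hv => joukowski_quad_lower (t x) (ht1 x hx) (ht2 x hx) v r hv hr
  have hdiff : DifferentiableOn ℂ 𝒢 (Metric.ball 0 1) := by
    intro v₀ hv₀
    rw [mem_ball_zero_iff] at hv₀
    obtain ⟨r, hr0, hr1⟩ := exists_between hv₀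
    have hpos : 0 < (1 - r) ^ 2 := by
      have : 0 < 1 - r := by linarith
      positivity
    have hne : ∀ x ∈ Set.Icc a b, ∀ v : ℂ, ‖v‖ ≤ r → P v x ≠ 0 := by
      intro x hx v hv h
      have := hlow r hr1 x hx v hv
      rw [h, norm_zero] at this
      linarith
    have key := hasDerivAt_integral_of_dominated_loc_of_deriv_le (μ := μ) (F := F) (F' := F')
      (x₀ := v₀) (s := Metric.ball 0 r)
      (bound := fun _ => ‖k‖ * (2 / ((1 - r) ^ 2) ^ 2))
      (Metric.isOpen_ball.mem_nhds (by simpa using hr0))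
      (Filter.Eventually.of_forall fun v =>
        ((measurable_const.div (hPm v)).const_mul k).aestronglyMeasurable)
      ?_
      ((measurable_const.div ((hPm v₀).pow_const 2)).const_mul k).aestronglyMeasurable
      ?_ (integrable_const _) ?_
    · rw [hG]
      exact key.2.differentiableAt.differentiableWithinAt
    · refine Integrable.of_bound
        ((measurable_const.div (hPm v₀)).const_mul k).aestronglyMeasurable
        (‖k‖ * (1 / (1 - r) ^ 2)) ?_
      filter_upwards [hae] with x hx
      simp only [F]
      rw [norm_mul, norm_div v₀ (P v₀ x)]
      have := hlow r hr1 x hx v₀ hr0.le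
      gcongr
    · filter_upwards [hae] with x hx v hv
      rw [mem_ball_zero_iff] at hv
      have := hlow r hr1 x hx v hv.le
      have h2 : ‖1 - v ^ 2‖ ≤ 2 := by
        have h3 := norm_sub_le (1 : ℂ) (v ^ 2)
        rw [norm_one, norm_pow] at h3
        have : ‖v‖ ^ 2 ≤ 1 := pow_le_one₀ (norm_nonneg _) (by linarith)
        linarith
      simp only [F']
      rw [norm_mul, norm_div (1 - v ^ 2) (P v x ^ 2), norm_pow (P v x)]
      gcongr
    · filter_upwards [hae] with x hx v hv
      rw [mem_ball_zero_iff] at hv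
      have hP0 := hne x hx v hv.le
      have hP : HasDerivAt (fun v => P v x) (2 * v - 2 * (t x : ℂ)) v := by
        have h1 := (((hasDerivAt_id v).pow 2).sub
          ((hasDerivAt_id v).const_mul (2 * (t x : ℂ)))).add_const (1 : ℂ)
        refine h1.congr_deriv ?_
        simp
      refine (((hasDerivAt_id v).div hP hP0).const_mul k).congr_deriv ?_
      simp only [F', P, id]
      congr 2
      ring
  intro v hv
  exact hdiff.analyticAt (Metric.isOpen_ball.mem_nhds hv)
end
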